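/- arXiv:2101.07178 — 2 statements merged into one kernel-verified Lean document; each statement's English description precedes it below -/
import Mathlib

section
/- Let n ≥ 1, let W be a real n×n matrix with ‖I − W‖_∞ < 1 (where ‖·‖_∞ is the operator norm induced by the supremum norm on ℝⁿ, i.e., the maximum absolute row sum), let b ∈ ℝⁿ, and let H_p be the partition matrix of a partition p of {1,…,n}. Then for every initial vector x(0) ∈ ℝⁿ, the sequence defined by the best response dynamics x(t+1) = max(0, (I − W)·H_p·x(t) + b) (with max taken componentwise) converges as t → ∞. -/
open Matrix Filter

/-- The size of the block of the partition (equivalence relation) `p` containing `i`. -/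
noncomputable def blockSize {n : ℕ} (p : Setoid (Fin n)) (i : Fin n) : ℕ :=
  Set.ncard {k | p.r i k}

open Classical in
/-- The partition matrix `H_p` of a partition `p` of `{1,…,n}`:
`(H_p)_{ij} = 1/l_i` if `i` and `j` lie in the same block of `p` (`l_i` the cardinality of
the block containing `i`), and `(H_p)_{ij} = 0` otherwise. -/
noncomputable def partitionMatrix {n : ℕ} (p : Setoid (Fin n)) : Matrix (Fin n) (Fin n) ℝ :=
  Matrix.of fun i j => if p.r i j then (1 : ℝ) / (blockSize p i : ℝ) else 0

/-- The operator norm on `n × n` real matrices induced by the supremum norm on `ℝⁿ`,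
i.e. the maximum absolute row sum. -/
noncomputable def rowSumNorm {n : ℕ} (A : Matrix (Fin n) (Fin n) ℝ) : ℝ :=
  ⨆ i, ∑ j, |A i j|

lemma abs_mulVec_le_rowSumNorm {n : ℕ} (A : Matrix (Fin n) (Fin n) ℝ) (v : Fin n → ℝ)
    (i : Fin n) : |(A *ᵥ v) i| ≤ rowSumNorm A * ‖v‖ := by
  calc |(A *ᵥ v) i| ≤ ∑ j, |A i j * v j| :=
        Finset.abs_sum_le_sum_abs (fun j => A i j * v j) Finset.univ
    _ ≤ ∑ j, |A i j| * ‖v‖ := by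
        refine Finset.sum_le_sum fun j _ => ?_
        rw [abs_mul]
        exact mul_le_mul_of_nonneg_left (norm_le_pi_norm v j) (abs_nonneg _)
    _ = (∑ j, |A i j|) * ‖v‖ := (Finset.sum_mul ..).symm
    _ ≤ rowSumNorm A * ‖v‖ :=
        mul_le_mul_of_nonneg_right
          (le_ciSup (f := fun i => ∑ j, |A i j|) (Set.finite_range _).bddAbove i) (norm_nonneg v)

lemma rowSumNorm_nonneg {n : ℕ} (A : Matrix (Fin n) (Fin n) ℝ) : 0 ≤ rowSumNorm A :=
  Real.iSup_nonneg fun _ => Finset.sum_nonneg fun _ _ => abs_nonneg _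

lemma norm_mulVec_le_rowSumNorm {n : ℕ} (A : Matrix (Fin n) (Fin n) ℝ) (v : Fin n → ℝ) :
    ‖A *ᵥ v‖ ≤ rowSumNorm A * ‖v‖ :=
  (pi_norm_le_iff_of_nonneg (mul_nonneg (rowSumNorm_nonneg A) (norm_nonneg v))).2
    (abs_mulVec_le_rowSumNorm A v)

lemma rowSumNorm_partitionMatrix_le_one {n : ℕ} (p : Setoid (Fin n)) :
    rowSumNorm (partitionMatrix p) ≤ 1 := by
  classical
  refine Real.iSup_le (fun i => le_of_eq ?_) zero_le_one
  have hcard : blockSize p i = (Finset.univ.filter fun k => p.r i k).card := by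
    rw [blockSize, ← Set.ncard_coe_finset]
    simp
  have hpos : (blockSize p i : ℝ) ≠ 0 := by
    rw [hcard, Nat.cast_ne_zero]
    exact Finset.card_ne_zero_of_mem (Finset.mem_filter.2 ⟨Finset.mem_univ i, p.refl i⟩)
  have habs : ∀ j, |partitionMatrix p i j| =
      if p.r i j then (1 : ℝ) / (blockSize p i : ℝ) else 0 := by
    intro j
    by_cases h : p.r i j <;> simp [partitionMatrix, h]
  simp_rw [habs]
  rw [← Finset.sum_filter, Finset.sum_const, nsmul_eq_mul, ← hcard, mul_one_div_cancel hpos]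

/-- The best response map is a contraction for the supremum norm. -/
lemma contractingWith_bestResponse {n : ℕ} {A : Matrix (Fin n) (Fin n) ℝ}
    (hA : rowSumNorm A < 1) (b : Fin n → ℝ) (p : Setoid (Fin n)) :
    ContractingWith ⟨rowSumNorm A, rowSumNorm_nonneg A⟩
      (fun v : Fin n → ℝ => fun i => max 0 (((A * partitionMatrix p) *ᵥ v) i + b i)) := by
  refine ⟨hA, LipschitzWith.of_dist_le_mul fun u v => ?_⟩
  refine (dist_pi_le_iff (mul_nonneg (rowSumNorm_nonneg A) dist_nonneg)).2 fun i => ?_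
  rw [dist_eq_norm u v, Real.dist_eq]
  calc _ ≤ |(((A * partitionMatrix p) *ᵥ u) i + b i) -
          (((A * partitionMatrix p) *ᵥ v) i + b i)| := by
        simpa using abs_max_sub_max_le_max 0 (((A * partitionMatrix p) *ᵥ u) i + b i) 0
          (((A * partitionMatrix p) *ᵥ v) i + b i)
    _ = |(A *ᵥ (partitionMatrix p *ᵥ (u - v))) i| := by
        rw [mulVec_mulVec, mulVec_sub, Pi.sub_apply, add_sub_add_right_eq_sub]
    _ ≤ rowSumNorm A * ‖partitionMatrix p *ᵥ (u - v)‖ := abs_mulVec_le_rowSumNorm _ _ _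
    _ ≤ rowSumNorm A * ‖u - v‖ := by
        refine mul_le_mul_of_nonneg_left ?_ (rowSumNorm_nonneg A)
        exact (norm_mulVec_le_rowSumNorm _ _).trans
          (mul_le_of_le_one_left (norm_nonneg _) (rowSumNorm_partitionMatrix_le_one p))

/-- Under `‖I − W‖_∞ < 1`, for every initial condition the best response dynamics
`x(t+1) = max (0, (I − W) H_p x(t) + b)` converges. -/
theorem bestResponse_converges {n : ℕ} (hn : 1 ≤ n) (W : Matrix (Fin n) (Fin n) ℝ)
    (hW : rowSumNorm (1 - W) < 1) (b : Fin n → ℝ) (p : Setoid (Fin n))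
    (x : ℕ → Fin n → ℝ)
    (hx : ∀ t, x (t + 1) = fun i => max 0 (((1 - W) * partitionMatrix p).mulVec (x t) i + b i)) :
    ∃ L : Fin n → ℝ, Tendsto x atTop (nhds L) := by
  have hf := contractingWith_bestResponse hW b p
  refine ⟨hf.fixedPoint, (hf.tendsto_iterate_fixedPoint (x 0)).congr fun t => ?_⟩
  induction t with
  | zero => rfl
  | succ t ih => rw [Function.iterate_succ_apply', ih, hx t]
end

section
/- Let n ≥ 1, let W be a real n×n matrix with γ := ‖I − W‖_∞ < 1, let b ∈ ℝⁿ with b_j > 0 for all j, let H_p be the partition matrix of a partition p of {1,…,n}, and let x* be the unique vector satisfying x* = max(0, (I − W)·H_p·x* + b) componentwise. If min_{j} b_j > (γ/(1 − γ))·max_{j} b_j, then x*_i > 0 for every i ∈ {1,…,n}. -/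
open Matrix Filter

theorem partitionMatrix_nonneg {n : ℕ} (p : Setoid (Fin n)) (i j : Fin n) :
    0 ≤ partitionMatrix p i j := by
  simp only [partitionMatrix, Matrix.of_apply]
  split_ifs <;> positivity

theorem sum_partitionMatrix_row {n : ℕ} (p : Setoid (Fin n)) (i : Fin n) :
    ∑ j, partitionMatrix p i j = 1 := by
  classical
  have hcard : blockSize p i = (Finset.univ.filter fun j => p.r i j).card := by
    rw [blockSize, ← Set.ncard_coe_finset]
    simp
  have hpos : 0 < blockSize p i := by
    rw [hcard, Finset.card_pos]
    exact ⟨i, by simp⟩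
  have hne : (blockSize p i : ℝ) ≠ 0 := by exact_mod_cast hpos.ne'
  simp only [partitionMatrix, Matrix.of_apply]
  rw [← Finset.sum_filter, Finset.sum_const, nsmul_eq_mul]
  refine Eq.trans ?_ (mul_one_div_cancel hne)
  congr 2
  rw [hcard]

theorem abs_partitionMatrix_mulVec_le {n : ℕ} (p : Setoid (Fin n)) {x : Fin n → ℝ} {c : ℝ}
    (hx : ∀ j, |x j| ≤ c) (i : Fin n) : |(partitionMatrix p).mulVec x i| ≤ c := by
  calc |(partitionMatrix p).mulVec x i|
      ≤ ∑ j, |partitionMatrix p i j * x j| := by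
        simp only [Matrix.mulVec, dotProduct]
        exact Finset.abs_sum_le_sum_abs _ _
    _ ≤ ∑ j, partitionMatrix p i j * c := by
        gcongr with j
        rw [abs_mul, abs_of_nonneg (partitionMatrix_nonneg p i j)]
        exact mul_le_mul_of_nonneg_left (hx j) (partitionMatrix_nonneg p i j)
    _ = c := by rw [← Finset.sum_mul, sum_partitionMatrix_row, one_mul]

theorem sum_abs_row_le_rowSumNorm {n : ℕ} (A : Matrix (Fin n) (Fin n) ℝ) (i : Fin n) :
    ∑ j, |A i j| ≤ rowSumNorm A :=
  le_ciSup (f := fun i => ∑ j, |A i j|) (Set.finite_range _).bddAbove i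

theorem abs_mulVec_le_rowSumNorm_mul {n : ℕ} (A : Matrix (Fin n) (Fin n) ℝ) {x : Fin n → ℝ}
    {c : ℝ} (hx : ∀ j, |x j| ≤ c) (i : Fin n) : |A.mulVec x i| ≤ rowSumNorm A * c := by
  have hc : 0 ≤ c := (abs_nonneg _).trans (hx i)
  calc |A.mulVec x i| ≤ ∑ j, |A i j * x j| := by
        simp only [Matrix.mulVec, dotProduct]
        exact Finset.abs_sum_le_sum_abs _ _
    _ ≤ ∑ j, |A i j| * c := by
        gcongr with j
        rw [abs_mul]
        exact mul_le_mul_of_nonneg_left (hx j) (abs_nonneg _)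
    _ ≤ rowSumNorm A * c := by
        rw [← Finset.sum_mul]
        exact mul_le_mul_of_nonneg_right (sum_abs_row_le_rowSumNorm A i) hc

/-- If `min_j b_j > (γ/(1−γ)) · max_j b_j` with `γ = ‖I − W‖_∞ < 1`, then the unique
equilibrium of the best response dynamics is componentwise positive. -/
theorem equilibrium_pos {n : ℕ} (hn : 1 ≤ n) (W : Matrix (Fin n) (Fin n) ℝ)
    (hW : rowSumNorm (1 - W) < 1) (b : Fin n → ℝ) (hb : ∀ j, 0 < b j)
    (p : Setoid (Fin n)) (xs : Fin n → ℝ)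
    (hxs : xs = fun i => max 0 (((1 - W) * partitionMatrix p).mulVec xs i + b i))
    (hmin : (rowSumNorm (1 - W) / (1 - rowSumNorm (1 - W))) * (⨆ j, b j) < ⨅ j, b j) :
    ∀ i, 0 < xs i := by
  intro i
  have hfix : ∀ k, xs k = max 0 (((1 - W) * partitionMatrix p).mulVec xs k + b k) :=
    fun k => congrFun hxs k
  have hnonneg : ∀ k, 0 ≤ xs k := fun k => by
    rw [hfix k]
    exact le_max_left _ _
  have : Nonempty (Fin n) := ⟨i⟩
  obtain ⟨m, hm⟩ := Finite.exists_max xs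
  have habs : ∀ k, |((1 - W) * partitionMatrix p).mulVec xs k| ≤ rowSumNorm (1 - W) * xs m := by
    intro k
    rw [← Matrix.mulVec_mulVec]
    refine abs_mulVec_le_rowSumNorm_mul _ (abs_partitionMatrix_mulVec_le p fun j => ?_) k
    rw [abs_of_nonneg (hnonneg j)]
    exact hm j
  have hsup : ∀ k, b k ≤ ⨆ j, b j := le_ciSup (Set.finite_range b).bddAbove
  have hinf : ∀ k, ⨅ j, b j ≤ b k := ciInf_le (Set.finite_range b).bddBelow
  have hγ : 0 ≤ rowSumNorm (1 - W) :=
    (Finset.sum_nonneg fun _ _ => abs_nonneg _).trans (sum_abs_row_le_rowSumNorm (1 - W) i)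
  have hγ' : 0 < 1 - rowSumNorm (1 - W) := sub_pos.mpr hW
  have hmax : xs m ≤ rowSumNorm (1 - W) * xs m + ⨆ j, b j := by
    conv_lhs => rw [hfix m]
    refine max_le ?_ (add_le_add ((le_abs_self _).trans (habs m)) (hsup m))
    exact add_nonneg (mul_nonneg hγ (hnonneg m)) ((hb m).le.trans (hsup m))
  have hbound : xs m ≤ (⨆ j, b j) / (1 - rowSumNorm (1 - W)) := by
    rw [le_div_iff₀ hγ']
    linarith
  have hlt : rowSumNorm (1 - W) * xs m < ⨅ j, b j := by
    refine (mul_le_mul_of_nonneg_left hbound hγ).trans_lt ?_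
    rwa [← mul_div_assoc, ← div_mul_eq_mul_div]
  rw [hfix i]
  refine lt_max_of_lt_right ?_
  linarith [neg_abs_le (((1 - W) * partitionMatrix p).mulVec xs i), habs i, hinf i]
end
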